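/- arXiv:2508.01187 — 2 statements merged into one kernel-verified Lean document; each statement's English description precedes it below -/
import Mathlib

section
/- For every integer k ≥ 3 and prime p ≥ k, there exist a constant C > 0, a function ε : ℝ⁺ → ℝ⁺ with ε(x) → 0 as x → ∞, and a constant c > 0, such that the following holds with probability tending to 1 as n → ∞: if S ⊆ 𝔽_p^n is formed by selecting at most binom(n+k-2, k-1) − C·(log_p n)^{1+ε(n)}·n^{k-2} elements independently and uniformly at random, then there exists a set A ⊆ 𝔽_p^n with |A| ≥ c·p^n that contains no proper k-term arithmetic progression (x, x+d, …, x+(k−1)d) with common difference d ∈ S. -/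
namespace RandomDifferences

open Finset MvPolynomial

/-- Along a line `t ↦ x + t d`, a homogeneous polynomial `P` of degree `e` is a polynomial in `t`
of degree at most `e` whose `t ^ e` coefficient is `P d`. -/
lemma exists_polynomial_eval_line {R σ : Type*} [CommRing R] {e : ℕ}
    {P : MvPolynomial σ R} (hP : P.IsHomogeneous e) (x d : σ → R) :
    ∃ q : Polynomial R, q.natDegree ≤ e ∧ q.coeff e = eval d P ∧
      ∀ t, q.eval t = eval (x + t • d) P := by
  classical
  have hmon : ∀ c : σ →₀ ℕ, ∀ s : Finset σ,
      (∏ i ∈ s, (Polynomial.C (d i) * Polynomial.X + Polynomial.C (x i)) ^ c i).natDegree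
        ≤ ∑ i ∈ s, c i ∧
      (∏ i ∈ s, (Polynomial.C (d i) * Polynomial.X + Polynomial.C (x i)) ^ c i).coeff
        (∑ i ∈ s, c i) = ∏ i ∈ s, d i ^ c i := by
    intro c s
    induction s using Finset.induction_on with
    | empty => simp
    | insert i s hi ih =>
      rw [prod_insert hi, sum_insert hi, prod_insert hi]
      have h1 : ((Polynomial.C (d i) * Polynomial.X + Polynomial.C (x i)) ^ c i).natDegree ≤ c i :=
        (Polynomial.natDegree_pow_le_of_le _ Polynomial.natDegree_linear_le).trans (by simp)
      refine ⟨Polynomial.natDegree_mul_le_of_le h1 ih.1, ?_⟩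
      rw [Polynomial.coeff_mul_add_eq_of_natDegree_le h1 ih.1, ih.2]
      have h2 := Polynomial.coeff_pow_of_natDegree_le (m := c i)
        (Polynomial.natDegree_linear_le (a := d i) (b := x i))
      rw [mul_one] at h2
      rw [h2]
      simp
  have hdeg : ∀ c ∈ P.support, ∑ i ∈ c.support, c i = e := fun c hc => by
    simpa [Finsupp.weight_apply, Finsupp.sum] using hP (mem_support_iff.1 hc)
  refine ⟨∑ c ∈ P.support, Polynomial.C (coeff c P) *
    ∏ i ∈ c.support, (Polynomial.C (d i) * Polynomial.X + Polynomial.C (x i)) ^ c i, ?_, ?_, ?_⟩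
  · refine Polynomial.natDegree_sum_le_of_forall_le _ _ fun c hc => ?_
    refine (Polynomial.natDegree_C_mul_le _ _).trans ?_
    rw [← hdeg c hc]
    exact (hmon c c.support).1
  · rw [Polynomial.finsetSum_coeff, eval_eq]
    refine sum_congr rfl fun c hc => ?_
    rw [Polynomial.coeff_C_mul, ← (hmon c c.support).2, hdeg c hc]
  · intro t
    rw [Polynomial.eval_finsetSum, eval_eq]
    refine sum_congr rfl fun c _ => ?_
    simp only [Polynomial.eval_mul, Polynomial.eval_C, Polynomial.eval_prod, Polynomial.eval_pow,
      Polynomial.eval_add, Polynomial.eval_X, Pi.add_apply, Pi.smul_apply, smul_eq_mul]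
    congr 1
    exact prod_congr rfl fun i _ => by ring

/-- A non-constant homogeneous polynomial of degree `e` that is constant on `e + 1` points of a
proper arithmetic progression vanishes at its common difference. -/
lemma eval_eq_zero_of_const_on_progression {p e : ℕ} [Fact p.Prime] {σ : Type*} (he : 1 ≤ e)
    (hep : e + 1 ≤ p) {P : MvPolynomial σ (ZMod p)} (hP : P.IsHomogeneous e) (x d : σ → ZMod p)
    (v : ZMod p) (h : ∀ j : Fin (e + 1), eval (x + (j : ℕ) • d) P = v) : eval d P = 0 := by
  obtain ⟨q, hq, hqe, hqt⟩ := exists_polynomial_eval_line hP x d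
  have hinj : Function.Injective (fun j : Fin (e + 1) => ((j : ℕ) : ZMod p)) := by
    intro i j hij
    have := (ZMod.natCast_eq_natCast_iff' _ _ _).1 hij
    rw [Nat.mod_eq_of_lt (by omega), Nat.mod_eq_of_lt (by omega)] at this
    exact Fin.ext this
  have h0 : q - Polynomial.C v = 0 := by
    refine Polynomial.eq_zero_of_natDegree_lt_card_of_eval_eq_zero _ hinj (fun j => ?_) ?_
    · simp only [Polynomial.eval_sub, Polynomial.eval_C, hqt, Nat.cast_smul_eq_nsmul, h j, sub_self]
    · rw [Polynomial.natDegree_sub_C]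
      rw [Fintype.card_fin]
      exact Nat.lt_succ_of_le hq
  rw [← hqe, sub_eq_zero.1 h0, Polynomial.coeff_C, if_neg (by omega)]

lemma exists_large_level_set {α : Type*} [Fintype α] [Nonempty α] {p : ℕ} [NeZero p]
    (g : α → ZMod p) : ∃ v, (Fintype.card α : ℝ) / p ≤ #{x | g x = v} := by
  obtain ⟨v, -, hv⟩ := exists_le_card_fiber_of_nsmul_le_card_of_maps_to (s := (univ : Finset α))
    (t := (univ : Finset (ZMod p))) (f := g) (b := (Fintype.card α : ℝ) / p)
    (fun a _ => mem_univ _) ⟨0, mem_univ _⟩ (by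
      have : (p : ℝ) ≠ 0 := by exact_mod_cast NeZero.ne p
      simp [ZMod.card]; field_simp; rfl)
  exact ⟨v, hv⟩

/-- The number of points of a set on which polynomials with leading exponents in `T` vanish is at
most the number of reduced monomials divisible by no element of `T`. -/
lemma card_le_card_standard {p n : ℕ} [Fact p.Prime] (m : MonomialOrder (Fin n))
    (Z : Finset (Fin n → ZMod p)) (T : Finset (Fin n →₀ ℕ))
    (hT : ∀ a ∈ T, ∃ P : MvPolynomial (Fin n) (ZMod p), P ≠ 0 ∧ m.degree P = a ∧
      ∀ z ∈ Z, eval z P = 0) :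
    #Z ≤ #{b : Fin n → Fin p | ∀ a ∈ T, ∃ i, (b i : ℕ) < a i} := by
  classical
  choose! Q hQ0 hQd hQz using hT
  let B : T ⊕ Fin n → MvPolynomial (Fin n) (ZMod p) :=
    Sum.elim (fun a => Q a) (fun i => ∏ r : ZMod p, (X i - C r))
  have hB : ∀ i, IsUnit (m.leadingCoeff (B i)) := by
    rintro (a | i)
    · simpa [B] using hQ0 a a.2
    · have : m.Monic (∏ r : ZMod p, (X i - C r) : MvPolynomial (Fin n) (ZMod p)) :=
        MonomialOrder.Monic.prod fun r _ => m.monic_X_sub_C i r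
      simp [B, this.leadingCoeff_eq_one]
  have hBz : ∀ i, ∀ z ∈ Z, eval z (B i) = 0 := by
    rintro (a | i) z hz
    · exact hQz a a.2 z hz
    · simp only [B, Sum.elim_inr, map_prod]
      exact prod_eq_zero (mem_univ (z i)) (by simp)
  set S := ({b : Fin n → Fin p | ∀ a ∈ T, ∃ i, (b i : ℕ) < a i} : Finset (Fin n → Fin p)) with hS
  let Φ : (S → ZMod p) →ₗ[ZMod p] (Z → ZMod p) :=
    ∑ b : S, (LinearMap.proj b).smulRight (fun z : Z => ∏ i, z.1 i ^ (b.1 i : ℕ))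
  have hΦ : Function.Surjective Φ := by
    intro y
    let f : MvPolynomial (Fin n) (ZMod p) := ∑ z : Z, C (y z) * indicator z.1
    have hf : ∀ z : Z, eval z.1 f = y z := by
      intro z
      simp only [f, map_sum, map_mul, eval_C]
      rw [sum_eq_single z]
      · simp [eval_indicator_apply_eq_one]
      · intro w _ hw
        rw [eval_indicator_apply_eq_zero _ _ (fun h => hw (Subtype.ext h.symm)), mul_zero]
      · simp
    obtain ⟨g, r, hfr, -, hr⟩ := m.div hB f
    have hrz : ∀ z : Z, eval z.1 r = y z := by
      intro z
      rw [← hf z, hfr, map_add, Finsupp.linearCombination_apply, Finsupp.sum, map_sum,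
        sum_eq_zero, zero_add]
      intro i _
      simp [hBz i z.1 z.2]
    have hlt : ∀ c ∈ r.support, ∀ i, c i < p := by
      intro c hc i
      by_contra! h
      refine hr c hc (Sum.inr i) ?_
      have : m.degree (B (Sum.inr i)) = Finsupp.single i p := by
        simp only [B, Sum.elim_inr]
        rw [MonomialOrder.degree_prod_of_regular]
        · simp [MonomialOrder.degree_X_sub_C, ZMod.card]
        · intro r _
          simp [(m.monic_X_sub_C i r).leadingCoeff_eq_one, isRegular_one]
      rw [this]
      simpa using h
    have hns : ∀ c ∈ r.support, ∀ a ∈ T, ∃ i, c i < a i := by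
      intro c hc a ha
      have := hr c hc (Sum.inl ⟨a, ha⟩)
      simp only [B, Sum.elim_inl, hQd a ha, Finsupp.le_def] at this
      simpa using this
    refine ⟨fun b => coeff (Finsupp.equivFunOnFinite.symm fun i => (b.1 i : ℕ)) r, ?_⟩
    ext z
    rw [← hrz z, eval_eq']
    simp only [Φ, LinearMap.sum_apply, LinearMap.smulRight_apply, LinearMap.proj_apply,
      Finset.sum_apply, Pi.smul_apply, smul_eq_mul]
    symm
    refine sum_bij_ne_zero (fun c hc _ => ⟨fun i => ⟨c i, hlt c hc i⟩, by
      simpa [hS] using hns c hc⟩) ?_ ?_ ?_ ?_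
    · intros; exact mem_univ _
    · intro c hc _ c' hc' _ h
      ext i
      simpa using congrArg (fun b : S => (b.1 i : ℕ)) h
    · intro b _ hb
      have hb' := left_ne_zero_of_mul hb
      exact ⟨_, mem_support_iff.2 hb', by simpa using hb, by ext i; simp⟩
    · intro c hc _
      congr 2
      ext i
      simp
  have := LinearMap.finrank_le_finrank_of_surjective hΦ
  simpa using this

/-- For exponents with pairwise disjoint supports the divisibility events are independent. -/
lemma card_standard_le {p n e : ℕ} [NeZero p] (T : Finset (Fin n →₀ ℕ))
    (hdis : (T : Set (Fin n →₀ ℕ)).PairwiseDisjoint Finsupp.support)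
    (hcard : ∀ a ∈ T, #a.support ≤ e) (hlt : ∀ a ∈ T, ∀ i, a i < p) :
    (#{b : Fin n → Fin p | ∀ a ∈ T, ∃ i, (b i : ℕ) < a i} : ℝ)
      ≤ (1 - 1 / (p : ℝ) ^ e) ^ #T * (p : ℝ) ^ n := by
  classical
  have hp : 0 < p := Nat.pos_of_ne_zero (NeZero.ne p)
  have hp1 : (1 : ℝ) ≤ (p : ℝ) ^ e := one_le_pow₀ (by exact_mod_cast hp)
  induction T using Finset.induction_on with
  | empty => simp
  | insert a T ha ih =>
    have ih := ih (hdis.subset (by simp)) (fun a h => hcard a (mem_insert_of_mem h))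
      (fun a h => hlt a (mem_insert_of_mem h))
    set N : Finset (Fin n → Fin p) := {b | ∀ a ∈ T, ∃ i, (b i : ℕ) < a i} with hN
    have hsplit : ({b | ∀ c ∈ insert a T, ∃ i, (b i : ℕ) < c i} : Finset (Fin n → Fin p))
        = N.filter (fun b => ∃ i, (b i : ℕ) < a i) := by
      ext b; simp [hN, and_comm]
    have hadd := card_filter_add_card_filter_not (s := N) (fun b => ∃ i, (b i : ℕ) < a i)
    set M := N.filter (fun b => ¬ ∃ i, (b i : ℕ) < a i) with hM
    have key : #N ≤ #M * p ^ e := by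
      have h1 : #N ≤ #(M ×ˢ (univ : Finset (a.support → Fin p))) := by
        refine card_le_card_of_injOn
          (fun b => (fun i => if i ∈ a.support then ⟨a i, hlt a (mem_insert_self _ _) i⟩ else b i,
            fun i => b i)) ?_ ?_
        · intro b hb
          simp only [coe_product, Set.mem_prod, mem_coe, mem_univ, and_true]
          refine mem_filter.2 ⟨mem_filter.2 ⟨mem_univ _, fun a' ha' => ?_⟩, ?_⟩
          · obtain ⟨i, hi⟩ := (mem_filter.1 hb).2 a' ha'
            have hi' : i ∉ a.support := by
              have hd := hdis (mem_insert_of_mem ha') (mem_insert_self a T)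
                (fun h => ha (h ▸ ha'))
              refine fun h => (Finset.disjoint_left.1 hd) ?_ h
              exact Finsupp.mem_support_iff.2 (by omega)
            exact ⟨i, by simpa only [if_neg hi'] using hi⟩
          · rintro ⟨i, hi⟩
            by_cases h : i ∈ a.support
            · simp only [if_pos h] at hi; omega
            · simp [Finsupp.notMem_support_iff.1 h] at hi
        · intro b _ b' _ h
          simp only [Prod.mk.injEq] at h
          ext i : 1
          by_cases hi : i ∈ a.support
          · exact congrFun h.2 ⟨i, hi⟩
          · simpa only [if_neg hi] using congrFun h.1 i
      refine h1.trans ?_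
      rw [card_product]
      gcongr
      rw [card_univ, Fintype.card_fun, Fintype.card_fin, Fintype.card_coe]
      exact Nat.pow_le_pow_right hp (hcard a (mem_insert_self _ _))
    have key' : (#N : ℝ) / (p : ℝ) ^ e ≤ #M := by
      rw [div_le_iff₀ (by positivity)]; exact_mod_cast key
    rw [hsplit, card_insert_of_notMem ha, pow_succ]
    have hadd' : (#(N.filter (fun b => ∃ i, (b i : ℕ) < a i)) : ℝ) + #M = #N := by
      exact_mod_cast hadd
    have h0 : 0 ≤ 1 - 1 / (p : ℝ) ^ e := sub_nonneg.2 ((div_le_one (by positivity)).2 hp1)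
    calc (#(N.filter (fun b => ∃ i, (b i : ℕ) < a i)) : ℝ) ≤ #N - #N / (p : ℝ) ^ e := by linarith
      _ = (1 - 1 / (p : ℝ) ^ e) * #N := by ring
      _ ≤ (1 - 1 / (p : ℝ) ^ e) * ((1 - 1 / (p : ℝ) ^ e) ^ #T * (p : ℝ) ^ n) := by gcongr
      _ = _ := by ring

lemma card_monomials_divisible_by_variable_le (n e : ℕ) (i : Fin n) :
    #{a ∈ (univ : Finset (Fin n)).finsuppAntidiag (e + 1) | i ∈ a.support} ≤ (n + e - 1).choose e := by
  classical
  have : (n + e - 1).choose e = #((univ : Finset (Fin n)).finsuppAntidiag e) := by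
    rw [card_finsuppAntidiag_nat_eq_choose]; simp
  rw [this]
  refine card_le_card_of_surjOn (fun a => a + Finsupp.single i 1) ?_
  intro a ha
  simp only [coe_filter, mem_finsuppAntidiag, Set.mem_ofPred_eq, Finsupp.mem_support_iff] at ha
  have hle : Finsupp.single i 1 ≤ a := by simpa [Nat.one_le_iff_ne_zero] using ha.2
  refine ⟨a - Finsupp.single i 1, ?_, tsub_add_cancel_of_le hle⟩
  have h := ha.1.1
  rw [← tsub_add_cancel_of_le hle, ← Finsupp.degree_eq_sum, map_add, Finsupp.degree_single] at h
  rw [mem_coe, mem_finsuppAntidiag, ← Finsupp.degree_eq_sum]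
  exact ⟨by omega, subset_univ _⟩

lemma card_support_le_sum {σ : Type*} [Fintype σ] (a : σ →₀ ℕ) : #a.support ≤ ∑ i, a i := by
  rw [card_eq_sum_ones]
  calc ∑ i ∈ a.support, 1 ≤ ∑ i ∈ a.support, a i :=
        sum_le_sum fun i hi => Nat.one_le_iff_ne_zero.2 (Finsupp.mem_support_iff.1 hi)
    _ ≤ ∑ i, a i := sum_le_sum_of_subset (subset_univ _)

/-- A large family of monomials of degree `e + 1` contains many with pairwise disjoint supports. -/
lemma exists_disjoint_subfamily {n e : ℕ} (L : Finset (Fin n →₀ ℕ))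
    (hL : ∀ a ∈ L, ∑ i, a i = e + 1) :
    ∃ T ⊆ L, (T : Set (Fin n →₀ ℕ)).PairwiseDisjoint Finsupp.support ∧
      #L ≤ #T * ((e + 1) * (n + e - 1).choose e) := by
  classical
  have hsupp : ∀ a ∈ L, #a.support ≤ e + 1 := fun a ha =>
    hL a ha ▸ card_support_le_sum a
  obtain ⟨T, hT, hmax⟩ := exists_max_image
    (L.powerset.filter fun T : Finset (Fin n →₀ ℕ) =>
      (T : Set (Fin n →₀ ℕ)).PairwiseDisjoint Finsupp.support) card
    ⟨∅, by simp⟩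
  rw [mem_filter, mem_powerset] at hT
  refine ⟨T, hT.1, hT.2, ?_⟩
  have hcover : L ⊆ (T.biUnion Finsupp.support).biUnion
      (fun i => {a ∈ (univ : Finset (Fin n)).finsuppAntidiag (e + 1) | i ∈ a.support}) := by
    intro a ha
    suffices h : ∃ i ∈ a.support, ∃ b ∈ T, i ∈ b.support by
      obtain ⟨i, hi, b, hb, hib⟩ := h
      refine mem_biUnion.2 ⟨i, mem_biUnion.2 ⟨b, hb, hib⟩, mem_filter.2 ⟨?_, hi⟩⟩
      simp [hL a ha]
    by_contra! hcon
    by_cases haT : a ∈ T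
    · have h0 : a.support = ∅ := by
        by_contra h
        obtain ⟨i, hi⟩ := nonempty_iff_ne_empty.2 h
        exact hcon i hi a haT hi
      have := hL a ha
      rw [Finsupp.support_eq_empty.1 h0] at this
      simp at this
    · have := hmax (insert a T) (mem_filter.2 ⟨mem_powerset.2 (insert_subset ha hT.1), by
        rw [coe_insert]
        refine hT.2.insert fun b hb _ => Finset.disjoint_left.2 fun i hi hib => hcon i hi b hb hib⟩)
      rw [card_insert_of_notMem haT] at this
      omega
  calc #L ≤ _ := card_le_card hcover
    _ ≤ #(T.biUnion Finsupp.support) * (n + e - 1).choose e :=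
        card_biUnion_le_card_mul _ _ _ fun i _ => card_monomials_divisible_by_variable_le n e i
    _ ≤ (#T * (e + 1)) * (n + e - 1).choose e := by
        gcongr
        exact card_biUnion_le_card_mul _ _ _ fun a ha => hsupp a (hT.1 ha)
    _ = _ := by ring

lemma finrank_le_card_leading_exponents {σ K : Type*} [Field K] (m : MonomialOrder σ)
    (V : Submodule K (MvPolynomial σ K)) (L : Finset (σ →₀ ℕ))
    (hL : ∀ P ∈ V, P ≠ 0 → m.degree P ∈ L) : Module.finrank K V ≤ #L := by
  let Φ : V →ₗ[K] (L → K) := LinearMap.pi fun a => (lcoeff K a.1).comp V.subtype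
  have hΦ : Function.Injective Φ := by
    rw [injective_iff_map_eq_zero]
    intro P hP
    by_contra h
    have h' : P.1 ≠ 0 := fun h0 => h (Subtype.ext h0)
    have := congrFun hP ⟨_, hL P.1 P.2 h'⟩
    exact m.coeff_degree_ne_zero_iff.2 h' (by simpa [Φ] using this)
  simpa using LinearMap.finrank_le_finrank_of_injective hΦ

lemma finrank_homogeneousSubmodule_fin (K : Type*) [Field K] (n e : ℕ) :
    Module.finrank K (homogeneousSubmodule (Fin n) K e) = (n + e - 1).choose e := by
  classical
  have h1 : {d : Fin n →₀ ℕ | d.degree = e} = ((univ : Finset (Fin n)).finsuppAntidiag e : Set _) := by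
    ext d; simp [Finsupp.degree_eq_sum]
  have h : (n + e - 1).choose e = #((univ : Finset (Fin n)).finsuppAntidiag e) := by
    rw [card_finsuppAntidiag_nat_eq_choose]; simp
  rw [h, homogeneousSubmodule_eq_finsupp_supported, h1]
  exact (Module.finrank_eq_card_basis (basisRestrictSupport K _)).trans (by simp)

instance finite_homogeneousSubmodule (K : Type*) [Field K] (n e : ℕ) :
    Module.Finite K (homogeneousSubmodule (Fin n) K e) :=
  Module.Finite.iff_fg.2 (homogeneousSubmodule_fg _ _ _)


lemma card_zeros_le {p n e : ℕ} [Fact p.Prime] (he : e + 1 < p)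
    (V : Submodule (ZMod p) (MvPolynomial (Fin n) (ZMod p)))
    (hV : V ≤ homogeneousSubmodule (Fin n) (ZMod p) (e + 1))
    (t : ℕ) (ht : t * ((e + 1) * (n + e - 1).choose e) ≤ Module.finrank (ZMod p) V) (hn : 1 ≤ n)
    (Z : Finset (Fin n → ZMod p)) (hZ : ∀ z ∈ Z, ∀ P ∈ V, eval z P = 0) :
    (#Z : ℝ) ≤ (1 - 1 / (p : ℝ) ^ (e + 1)) ^ t * (p : ℝ) ^ n := by
  classical
  let m : MonomialOrder (Fin n) := MonomialOrder.lex
  let L : Finset (Fin n →₀ ℕ) := ((univ : Finset (Fin n)).finsuppAntidiag (e + 1)).filter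
    fun a => ∃ P ∈ V, P ≠ 0 ∧ m.degree P = a
  have hmem : ∀ a ∈ L, ∑ i, a i = e + 1 := by
    intro a ha
    exact (mem_finsuppAntidiag.1 (mem_filter.1 ha).1).1
  have hVL : Module.finrank (ZMod p) V ≤ #L := by
    refine finrank_le_card_leading_exponents m V L fun P hP hP0 => ?_
    refine mem_filter.2 ⟨mem_finsuppAntidiag.2 ⟨?_, subset_univ _⟩, P, hP, hP0, rfl⟩
    have := hV hP (m.coeff_degree_ne_zero_iff.2 hP0)
    simpa [Finsupp.weight_apply, Finsupp.sum_fintype] using this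
  obtain ⟨T, hTL, hdis, hcard⟩ := exists_disjoint_subfamily L hmem
  have htT : t ≤ #T := by
    refine Nat.le_of_mul_le_mul_right (ht.trans (hVL.trans hcard)) ?_
    have := Nat.choose_pos (n := n + e - 1) (k := e) (by omega)
    positivity
  have h1 := card_le_card_standard m Z T fun a ha => by
    obtain ⟨-, P, hP, hP0, hPa⟩ := mem_filter.1 (hTL ha)
    exact ⟨P, hP0, hPa, fun z hz => hZ z hz P hP⟩
  have hai : ∀ a ∈ T, ∀ i, a i ≤ e + 1 := fun a ha i => by
    rw [← hmem a (hTL ha)]; exact single_le_sum (fun _ _ => Nat.zero_le _) (mem_univ i)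
  have hsupp : ∀ a ∈ T, #a.support ≤ e + 1 := fun a ha =>
    hmem a (hTL ha) ▸ card_support_le_sum a
  have h2 := card_standard_le (p := p) (e := e + 1) T hdis hsupp
    fun a ha i => (hai a ha i).trans_lt he
  have hp1 : (1 : ℝ) ≤ (p : ℝ) ^ (e + 1) :=
    one_le_pow₀ (by exact_mod_cast (Fact.out : p.Prime).one_lt.le)
  have h0 : 0 ≤ 1 - 1 / (p : ℝ) ^ (e + 1) := sub_nonneg.2 ((div_le_one (by positivity)).2 hp1)
  calc (#Z : ℝ) ≤ _ := by exact_mod_cast h1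
    _ ≤ _ := h2
    _ ≤ _ := by
      gcongr ?_ * _
      refine pow_le_pow_of_le_one h0 ?_ htT
      have : 0 ≤ 1 / (p : ℝ) ^ (e + 1) := by positivity
      linarith

/-- If few points are common zeros of every large subspace of `H`, then evaluation of `H` at `s`
points is surjective for most choices of these points. -/
lemma card_surjective_evaluation_ge {K X H : Type*} [Field K] [AddCommGroup H] [Module K H]
    [Module.Finite K H] [Fintype X] (ev : X → H →ₗ[K] K) (r : ℕ) (ρ : ℝ) (hρ : ρ ≤ 1)
    (hZ : ∀ V : Submodule K H, r ≤ Module.finrank K V → ∀ Z : Finset X,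
      (∀ z ∈ Z, ∀ P ∈ V, ev z P = 0) → (#Z : ℝ) ≤ ρ * Fintype.card X)
    (s : ℕ) (hs : s + r ≤ Module.finrank K H) :
    ((1 - ρ) * Fintype.card X) ^ s ≤
      (Nat.card {f : Fin s → X // Function.Surjective (LinearMap.pi fun i => ev (f i))} : ℝ) := by
  classical
  induction s with
  | zero =>
    have : Nonempty {f : Fin 0 → X // Function.Surjective (LinearMap.pi fun i => ev (f i))} :=
      ⟨⟨fun i => i.elim0, fun y => ⟨0, Subsingleton.elim _ _⟩⟩⟩
    have := Nat.card_pos (α := {f : Fin 0 → X // Function.Surjective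
      (LinearMap.pi fun i => ev (f i))})
    rw [pow_zero]
    exact_mod_cast this
  | succ s ih =>
    have ih := ih (by omega)
    let G := {f : Fin s → X // Function.Surjective (LinearMap.pi fun i => ev (f i))}
    let V : G → Submodule K H := fun f => LinearMap.ker (LinearMap.pi fun i => ev (f.1 i))
    have hV : ∀ f, r ≤ Module.finrank K (V f) := by
      intro f
      have h1 := LinearMap.finrank_range_add_finrank_ker (LinearMap.pi fun i => ev (f.1 i))
      have h2 := Submodule.finrank_le (LinearMap.range (LinearMap.pi fun i => ev (f.1 i)))
      rw [Module.finrank_fin_fun] at h2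
      change _ + Module.finrank K (V f) = _ at h1
      omega
    let E : (Σ f : G, {x : X // ∃ P ∈ V f, ev x P ≠ 0}) →
        {f : Fin (s + 1) → X // Function.Surjective (LinearMap.pi fun i => ev (f i))} :=
      fun a => ⟨Fin.cons a.2.1 a.1.1, by
        obtain ⟨⟨f, hf⟩, x, P, hP, hPx⟩ := a
        intro y
        obtain ⟨Q, hQ⟩ := hf (fun i => y i.succ)
        refine ⟨Q + ((y 0 - ev x Q) / ev x P) • P, ?_⟩
        ext i
        refine Fin.cases ?_ (fun j => ?_) i
        · simp [hPx]
        · have h1 : ev (f j) P = 0 := congrFun (LinearMap.mem_ker.1 hP) j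
          have h2 : ev (f j) Q = y j.succ := congrFun hQ j
          simp [h1, h2]⟩
    have hE : Function.Injective E := by
      rintro ⟨⟨f, hf⟩, x, hx⟩ ⟨⟨f', hf'⟩, x', hx'⟩ h
      have := congrArg Subtype.val h
      simp only [E] at this
      obtain ⟨rfl, rfl⟩ := Fin.cons_inj.1 this
      rfl
    have hge : ∀ f : G, (1 - ρ) * Fintype.card X ≤
        (Fintype.card {x : X // ∃ P ∈ V f, ev x P ≠ 0} : ℝ) := by
      intro f
      have h1 := hZ (V f) (hV f) (univ.filter fun x => ¬ ∃ P ∈ V f, ev x P ≠ 0) (by simp)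
      have h2 := card_filter_add_card_filter_not (s := (univ : Finset X))
        (fun x => ∃ P ∈ V f, ev x P ≠ 0)
      rw [Fintype.card_subtype]
      rw [card_univ] at h2
      rw [← h2]
      rw [← h2] at h1
      push_cast at h1 ⊢
      linarith
    have hle := Nat.card_le_card_of_injective E hE
    rw [Nat.card_sigma] at hle
    calc ((1 - ρ) * Fintype.card X) ^ (s + 1)
        = ((1 - ρ) * Fintype.card X) ^ s * ((1 - ρ) * Fintype.card X) := pow_succ _ _
      _ ≤ (Nat.card G : ℝ) * ((1 - ρ) * Fintype.card X) := by
          refine mul_le_mul_of_nonneg_right ih (mul_nonneg (by linarith) (by positivity))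
      _ = ∑ f : G, ((1 - ρ) * Fintype.card X) := by simp
      _ ≤ ∑ f : G, (Nat.card {x : X // ∃ P ∈ V f, ev x P ≠ 0} : ℝ) :=
          sum_le_sum fun f _ => by rw [Nat.card_eq_fintype_card]; exact hge f
      _ ≤ _ := by exact_mod_cast hle

/-- The probability estimate behind the main theorem, with explicit parameters. -/
lemma card_surjective_homogeneous_evaluation_ge {p n e t s : ℕ} [Fact p.Prime] (he : e + 1 < p)
    (hn : 1 ≤ n)
    (hs : s + t * ((e + 1) * (n + e - 1).choose e) ≤ (n + e).choose (e + 1)) :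
    (1 - s * (1 - 1 / (p : ℝ) ^ (e + 1)) ^ t) * (Fintype.card (Fin s → Fin n → ZMod p) : ℝ) ≤
      (Nat.card {f : Fin s → Fin n → ZMod p // ∃ P : MvPolynomial (Fin n) (ZMod p),
        P.IsHomogeneous (e + 1) ∧ ∀ i, eval (f i) P = 1} : ℝ) := by
  classical
  set q : ℝ := 1 / (p : ℝ) ^ (e + 1) with hq
  have hp1 : (1 : ℝ) ≤ (p : ℝ) ^ (e + 1) :=
    one_le_pow₀ (by exact_mod_cast (Fact.out : p.Prime).one_lt.le)
  have hq1 : q ≤ 1 := (div_le_one (by positivity)).2 hp1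
  have hq0 : 0 ≤ q := by positivity
  have hρ0 : 0 ≤ (1 - q) ^ t := pow_nonneg (by linarith) _
  have hρ1 : (1 - q) ^ t ≤ 1 := pow_le_one₀ (by linarith) (by linarith)
  have hX : (Fintype.card (Fin n → ZMod p) : ℝ) = (p : ℝ) ^ n := by simp [ZMod.card]
  let H := homogeneousSubmodule (Fin n) (ZMod p) (e + 1)
  let ev : (Fin n → ZMod p) → H →ₗ[ZMod p] ZMod p :=
    fun x => (aeval x).toLinearMap.comp H.subtype
  have hev : ∀ x (P : H), ev x P = eval x P.1 := fun x P => by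
    simp [ev, aeval_eq_eval]
  have hmain := card_surjective_evaluation_ge ev (t * ((e + 1) * (n + e - 1).choose e))
    ((1 - q) ^ t) hρ1 (fun V hV Z hZ => by
      rw [hX]
      refine card_zeros_le he (V.map H.subtype) (Submodule.map_subtype_le _ _) t ?_ hn Z ?_
      · rwa [LinearEquiv.finrank_eq (Submodule.equivSubtypeMap H V).symm]
      · rintro z hz _ ⟨P, hP, rfl⟩
        rw [← hZ z hz P hP, hev]; rfl) s
    (by rw [finrank_homogeneousSubmodule_fin]; exact hs)
  have hbern : 1 - s * (1 - q) ^ t ≤ (1 - (1 - q) ^ t) ^ s := by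
    have := one_add_mul_le_pow (a := -(1 - q) ^ t) (by linarith) s
    calc _ = 1 + s * (-(1 - q) ^ t) := by ring
      _ ≤ _ := this
      _ = _ := by ring
  calc _ ≤ (1 - (1 - q) ^ t) ^ s * (Fintype.card (Fin s → Fin n → ZMod p) : ℝ) := by gcongr
    _ = ((1 - (1 - q) ^ t) * Fintype.card (Fin n → ZMod p)) ^ s := by
      rw [mul_pow, Fintype.card_fun (α := Fin s), Fintype.card_fin, Nat.cast_pow]
    _ ≤ _ := hmain
    _ ≤ _ := by
      refine Nat.cast_le.2 (Nat.card_le_card_of_injective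
        (Subtype.map id fun f hf => ?_) (Subtype.map_injective _ Function.injective_id))
      obtain ⟨P, hP⟩ := hf (fun _ => 1)
      exact ⟨P.1, P.2, fun i => by rw [id, ← hev]; exact congrFun hP i⟩

lemma exists_dense_set_of_homogeneous {p n e s : ℕ} [Fact p.Prime] (he : e + 1 < p)
    (f : Fin s → Fin n → ZMod p) {P : MvPolynomial (Fin n) (ZMod p)}
    (hP : P.IsHomogeneous (e + 1)) (hf : ∀ i, eval (f i) P = 1) :
    ∃ A : Finset (Fin n → ZMod p), 1 / (p : ℝ) * (p : ℝ) ^ n ≤ (A.card : ℝ) ∧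
      ∀ x d : Fin n → ZMod p, (∃ i, f i = d) → d ≠ 0 →
        ¬ (∀ j : Fin (e + 2), x + (j : ℕ) • d ∈ A) := by
  obtain ⟨v, hv⟩ := exists_large_level_set (fun x => eval x P)
  refine ⟨univ.filter fun x => eval x P = v, ?_, ?_⟩
  · refine le_trans (le_of_eq ?_) hv
    simp [ZMod.card]; ring
  · rintro x _ ⟨i, rfl⟩ - h
    have := eval_eq_zero_of_const_on_progression (by omega) (by omega) hP x (f i) v
      fun j => (mem_filter.1 (h j)).2
    rw [hf i] at this
    exact one_ne_zero this

lemma one_sub_pow_le_inv_pow {q : ℝ} (hq : 0 < q) (hq1 : q ≤ 1) {n m t : ℕ} (hn : 1 ≤ n)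
    (ht : m / q * Real.log n ≤ t) : (1 - q) ^ t ≤ ((n : ℝ) ^ m)⁻¹ := by
  have hn0 : (0 : ℝ) < n := by exact_mod_cast hn
  calc (1 - q) ^ t ≤ Real.exp (-q) ^ t :=
        pow_le_pow_left₀ (by linarith) (Real.one_sub_le_exp_neg q) t
    _ = Real.exp (-(q * t)) := by rw [← Real.exp_nat_mul]; ring_nf
    _ ≤ Real.exp (-(m * Real.log n)) := by
        refine Real.exp_le_exp.2 (neg_le_neg ?_)
        calc m * Real.log n = q * (m / q * Real.log n) := by field_simp
          _ ≤ q * t := by gcongr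
    _ = ((n : ℝ) ^ m)⁻¹ := by
        rw [Real.exp_neg, Real.exp_nat_mul, Real.exp_log hn0]

lemma choose_le_mul_pow {n a e m : ℕ} (hn : 1 ≤ n) (ha : a ≤ m) :
    ((n + a).choose e : ℝ) ≤ ((m + 1 : ℝ) * n) ^ e := by
  have h1 : n + a ≤ (m + 1) * n := by nlinarith
  exact_mod_cast (Nat.choose_le_pow _ _).trans (Nat.pow_le_pow_left h1 e)

end RandomDifferences


/-- **Szemerédi's theorem with random differences: lower bound (main theorem).**
For every integer `k ≥ 3` and prime `p ≥ k`, there exist a constant `C > 0`, a function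
`ε : ℝ⁺ → ℝ⁺` tending to `0` at infinity, and a constant `c > 0`, such that with probability
tending to `1` as `n → ∞`, a set `S ⊆ 𝔽_p^n` formed by selecting at most
`binom(n+k-2, k-1) − C·(log_p n)^{1+ε(n)}·n^{k-2}` elements independently and uniformly at
random admits a set `A ⊆ 𝔽_p^n` with `|A| ≥ c·p^n` containing no proper `k`-term arithmetic
progression with common difference in `S`. -/
theorem stmt0 (k p : ℕ) (hk : 3 ≤ k) [hp : Fact p.Prime] (hkp : k ≤ p) :
    ∃ C : ℝ, 0 < C ∧
    ∃ ε : ℝ → ℝ, (∀ x : ℝ, 0 < x → 0 < ε x) ∧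
      Filter.Tendsto ε Filter.atTop (nhds 0) ∧
    ∃ c : ℝ, 0 < c ∧
      ∀ δ : ℝ, 0 < δ → ∃ N : ℕ, ∀ n : ℕ, N ≤ n → ∀ s : ℕ,
        (s : ℝ) ≤ ((n + k - 2).choose (k - 1) : ℝ)
            - C * (Real.logb p n) ^ ((1 : ℝ) + ε n) * (n : ℝ) ^ (k - 2) →
        (1 - δ) * (Fintype.card (Fin s → (Fin n → ZMod p)) : ℝ) ≤
          (Nat.card {f : Fin s → (Fin n → ZMod p) //
            ∃ A : Finset (Fin n → ZMod p), c * (p : ℝ) ^ n ≤ (A.card : ℝ) ∧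
              ∀ x d : Fin n → ZMod p, (∃ i, f i = d) → d ≠ 0 →
                ¬ (∀ j : Fin k, x + (j : ℕ) • d ∈ A)} : ℝ) := by
  obtain ⟨e, rfl⟩ : ∃ e, k = e + 2 := ⟨k - 2, by omega⟩
  have hp3 : 3 ≤ p := by omega
  have hpR : (3 : ℝ) ≤ p := by exact_mod_cast hp3
  have hlogp : 0 < Real.log p := Real.log_pos (by linarith)
  set q : ℝ := 1 / (p : ℝ) ^ (e + 1) with hq
  have hp1 : (1 : ℝ) ≤ (p : ℝ) ^ (e + 1) := one_le_pow₀ (by linarith)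
  have hq0 : 0 < q := by positivity
  have hq1 : q ≤ 1 := (div_le_one (by positivity)).2 hp1
  set K : ℝ := ((e + 2 : ℕ) : ℝ) / q with hK
  have hK1 : 1 ≤ K := by
    rw [hK, le_div_iff₀ hq0]
    push_cast
    have : (0 : ℝ) ≤ e := by positivity
    linarith
  refine ⟨2 * K * Real.log p * (e + 1) ^ (e + 1), by positivity, fun x => 1 / x,
    fun x hx => by positivity, tendsto_const_nhds.div_atTop Filter.tendsto_id,
    1 / p, by positivity, fun δ hδ => ?_⟩
  refine ⟨max p ⌈(e + 1 : ℝ) ^ (e + 1) / δ⌉₊, fun n hn s hs => ?_⟩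
  have hpn : p ≤ n := (le_max_left _ _).trans hn
  have hpnR : (p : ℝ) ≤ n := by exact_mod_cast hpn
  have hn1 : 1 ≤ n := by omega
  have hn0 : (0 : ℝ) < n := by exact_mod_cast hn1
  have hδn : (e + 1 : ℝ) ^ (e + 1) / δ ≤ n :=
    (Nat.le_ceil _).trans (by exact_mod_cast (le_max_right _ _).trans hn)
  have hlogn : 1 ≤ Real.log n := by
    rw [Real.le_log_iff_exp_le hn0]
    linarith [Real.exp_one_lt_d9]
  have hlogb : 1 ≤ Real.logb p n := by
    rw [Real.logb, le_div_iff₀ hlogp, one_mul]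
    exact Real.log_le_log (by linarith) hpnR
  set t : ℕ := ⌈K * Real.log n⌉₊ with ht
  have htle : (t : ℝ) ≤ 2 * K * Real.log n := by
    have := Nat.ceil_lt_add_one (a := K * Real.log n) (by positivity)
    nlinarith
  have hr : ((t * ((e + 1) * (n + e - 1).choose e) : ℕ) : ℝ) ≤
      2 * K * Real.log p * (e + 1) ^ (e + 1) * Real.logb p n ^ ((1 : ℝ) + 1 / n) *
        (n : ℝ) ^ (e + 2 - 2) := by
    have h1 : (((n + e - 1).choose e : ℕ) : ℝ) ≤ ((e + 1 : ℝ) * n) ^ e := by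
      refine le_trans ?_ (RandomDifferences.choose_le_mul_pow (a := e) hn1 le_rfl)
      exact_mod_cast Nat.choose_le_choose e (Nat.sub_le _ _)
    have h2 : Real.logb p n ≤ Real.logb p n ^ ((1 : ℝ) + 1 / n) := by
      refine Real.self_le_rpow_of_one_le hlogb ?_
      have : (0 : ℝ) ≤ 1 / n := by positivity
      linarith
    push_cast
    calc (t : ℝ) * ((e + 1) * ((n + e - 1).choose e : ℕ))
        ≤ (2 * K * Real.log n) * ((e + 1) * ((e + 1 : ℝ) * n) ^ e) := by gcongr
      _ = 2 * K * Real.log p * (e + 1) ^ (e + 1) * Real.logb p n * (n : ℝ) ^ e := by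
          rw [Real.logb, mul_pow]; field_simp; ring
      _ ≤ _ := by
          gcongr
  have hsD : s + t * ((e + 1) * (n + e - 1).choose e) ≤ (n + e).choose (e + 1) := by
    have h1 : n + (e + 2) - 2 = n + e := by omega
    have h2 : e + 2 - 1 = e + 1 := by omega
    rw [h1, h2] at hs
    have : ((s + t * ((e + 1) * (n + e - 1).choose e) : ℕ) : ℝ) ≤
        ((n + e).choose (e + 1) : ℕ) := by
      rw [Nat.cast_add]
      linarith
    exact_mod_cast this
  have hsδ : s * (1 - q) ^ t ≤ δ := by
    have h1 : (1 - q) ^ t ≤ ((n : ℝ) ^ (e + 2))⁻¹ :=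
      RandomDifferences.one_sub_pow_le_inv_pow hq0 hq1 hn1 (Nat.le_ceil _)
    have h2 : (s : ℝ) ≤ ((e + 1 : ℝ) * n) ^ (e + 1) := by
      refine le_trans ?_ (RandomDifferences.choose_le_mul_pow (a := e) hn1 le_rfl)
      exact_mod_cast (Nat.le_add_right _ _).trans hsD
    calc s * (1 - q) ^ t ≤ ((e + 1 : ℝ) * n) ^ (e + 1) * ((n : ℝ) ^ (e + 2))⁻¹ := by gcongr
      _ = (e + 1 : ℝ) ^ (e + 1) / n := by rw [mul_pow]; field_simp; ring
      _ ≤ δ := by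
          rw [div_le_iff₀ hδ] at hδn
          rw [div_le_iff₀ hn0]
          linarith
  calc (1 - δ) * (Fintype.card (Fin s → (Fin n → ZMod p)) : ℝ)
      ≤ (1 - s * (1 - q) ^ t) * (Fintype.card (Fin s → (Fin n → ZMod p)) : ℝ) := by gcongr
    _ ≤ _ := RandomDifferences.card_surjective_homogeneous_evaluation_ge (by omega) hn1 hsD
    _ ≤ _ := by
      refine Nat.cast_le.2 (Nat.card_le_card_of_injective
        (Subtype.map id fun f hf => ?_) (Subtype.map_injective _ Function.injective_id))
      obtain ⟨P, hP, hPf⟩ := hf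
      exact RandomDifferences.exists_dense_set_of_homogeneous (by omega) f hP hPf
end

section
/- For every integer k ≥ 3 and prime p ≥ k, there exist a constant γ_k ≥ 0 and a function ε : ℝ⁺ → ℝ⁺ with ε(x) → 0 as x → ∞ such that the following holds. Let s be a positive integer with s ≤ binom(n+k-2, k-1) − γ_k·(log_p n)^{1+ε(n)}·n^{k-2}, and let x_1, …, x_s be independent uniformly distributed random vectors in 𝔽_p^n. Then the vectors φ_{k-1}(x_1), …, φ_{k-1}(x_s) are linearly independent over 𝔽_p with probability 1 − o(1) as n → ∞. -/
/-- The degree-`d` Veronese map `𝔽_p^n → 𝔽_p^(binom(n+d-1,d))`, sending `x` to the vector of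
all degree-`d` monomials in the coordinates of `x`, one coordinate for each multiset of size
`d` from `{1,…,n}`. -/
def veronese (p n d : ℕ) (x : Fin n → ZMod p) : Sym (Fin n) d → ZMod p :=
  fun m => ((m : Multiset (Fin n)).map x).prod

section DegreeFiltration

variable {p : ℕ} {X : Type*} [AddCommGroup X]

/-- The finite difference operator `f ↦ f (· + h) - f`. -/
def finiteDiff (p : ℕ) {X : Type*} [AddCommGroup X] (h : X) :
    (X → ZMod p) →ₗ[ZMod p] (X → ZMod p) where
  toFun f x := f (x + h) - f x
  map_add' f g := by ext x; simp only [Pi.add_apply]; ring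
  map_smul' c f := by ext x; simp only [Pi.smul_apply, smul_eq_mul, RingHom.id_apply]; ring

@[simp]
theorem finiteDiff_apply (h : X) (f : X → ZMod p) (x : X) :
    finiteDiff p h f x = f (x + h) - f x := rfl

/-- The space of functions killed by any `d` finite differences, that is, of degree less
than `d`. -/
def degreeLTFun (p : ℕ) (X : Type*) [AddCommGroup X] : ℕ → Submodule (ZMod p) (X → ZMod p)
  | 0 => ⊥
  | d + 1 => ⨅ h, (degreeLTFun p X d).comap (finiteDiff p h)

theorem mem_degreeLTFun_succ {d : ℕ} {f : X → ZMod p} :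
    f ∈ degreeLTFun p X (d + 1) ↔ ∀ h, finiteDiff p h f ∈ degreeLTFun p X d := by
  simp [degreeLTFun]

theorem map_finiteDiff_le {d : ℕ} {V : Submodule (ZMod p) (X → ZMod p)}
    (hV : V ≤ degreeLTFun p X (d + 1)) (h : X) :
    V.map (finiteDiff p h) ≤ degreeLTFun p X d :=
  Submodule.map_le_iff_le_comap.2 fun _ hf => mem_degreeLTFun_succ.1 (hV hf) h

theorem const_mem_degreeLTFun (d : ℕ) (c : ZMod p) :
    (fun _ => c : X → ZMod p) ∈ degreeLTFun p X (d + 1) := by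
  refine mem_degreeLTFun_succ.2 fun h => ?_
  have : finiteDiff p h (fun _ => c) = 0 := by ext x; simp
  rw [this]
  exact zero_mem _

theorem translate_mem_degreeLTFun (h : X) {d : ℕ} {f : X → ZMod p}
    (hf : f ∈ degreeLTFun p X d) : (fun x => f (x + h)) ∈ degreeLTFun p X d := by
  induction d generalizing f with
  | zero =>
    have : f = 0 := by simpa [degreeLTFun] using hf
    subst this
    exact zero_mem _
  | succ d ih =>
    refine mem_degreeLTFun_succ.2 fun k => ?_
    convert ih (mem_degreeLTFun_succ.1 hf k) using 1
    ext x
    simp [add_right_comm]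

theorem linear_mul_mem_degreeLTFun (l : X →+ ZMod p) {d : ℕ} {f : X → ZMod p}
    (hf : f ∈ degreeLTFun p X d) : (fun x => l x * f x) ∈ degreeLTFun p X (d + 1) := by
  induction d generalizing f with
  | zero =>
    have : f = 0 := by simpa [degreeLTFun] using hf
    subst this
    simpa using const_mem_degreeLTFun 0 (0 : ZMod p)
  | succ d ih =>
    refine mem_degreeLTFun_succ.2 fun h => ?_
    convert add_mem (ih (mem_degreeLTFun_succ.1 hf h))
      (Submodule.smul_mem _ (l h) (translate_mem_degreeLTFun h hf)) using 1
    ext x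
    simp only [finiteDiff_apply, map_add, Pi.add_apply, Pi.smul_apply, smul_eq_mul]
    ring

variable [Fact p.Prime] [Module (ZMod p) X]

/-- A function whose finite differences along a spanning set vanish is constant. -/
theorem eq_of_finiteDiff_eq_zero {e : Set X} (he : Submodule.span (ZMod p) e = ⊤)
    {f : X → ZMod p} (hf : ∀ h ∈ e, finiteDiff p h f = 0) (x : X) : f x = f 0 := by
  have key : ∀ h : X, ∀ y, f (y + h) = f y := by
    intro h
    have hh : h ∈ Submodule.span (ZMod p) e := he ▸ Submodule.mem_top
    induction hh using Submodule.span_induction with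
    | mem h hh => exact fun y => sub_eq_zero.1 (congrFun (hf h hh) y)
    | zero => simp
    | add a b _ _ ha hb => intro y; rw [← add_assoc, hb, ha]
    | smul c a _ ha =>
      have hn : ∀ (m : ℕ) (y : X), f (y + m • a) = f y := by
        intro m
        induction m with
        | zero => simp
        | succ m ih => intro y; rw [succ_nsmul, ← add_assoc, ha, ih]
      intro y
      have := hn c.val y
      rwa [← Nat.cast_smul_eq_nsmul (ZMod p), ZMod.natCast_zmod_val] at this
  simpa using key x 0

/-- If finitely many linear maps jointly separate points of a subspace, its dimension is at most
the sum of the dimensions of the images. -/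
theorem finrank_le_sum_finrank_map {K E F ι : Type*} [Field K] [AddCommGroup E] [Module K E]
    [AddCommGroup F] [Module K F] [FiniteDimensional K F] (s : Finset ι) (T : ι → E →ₗ[K] F)
    (V : Submodule K E) (hV : ∀ f ∈ V, (∀ i ∈ s, T i f = 0) → f = 0) :
    Module.finrank K V ≤ ∑ i ∈ s, Module.finrank K (V.map (T i)) := by
  let Φ : V →ₗ[K] (i : s) → V.map (T i) := LinearMap.pi fun i => (T i).submoduleMap V
  have hΦ : Function.Injective Φ := by
    refine (injective_iff_map_eq_zero Φ).2 fun v hv => ?_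
    refine Subtype.ext (hV v v.2 fun i hi => ?_)
    exact congrArg Subtype.val (congrFun hv ⟨i, hi⟩)
  refine (LinearMap.finrank_le_finrank_of_injective hΦ).trans_eq ?_
  rw [Module.finrank_pi_fintype, Finset.sum_coe_sort s fun i => Module.finrank K (V.map (T i))]

variable [Fintype X]

/-- A spanning set of size `dim X` that contains a spanning subset of `span H`. -/
theorem exists_finset_basis (H : Set X) :
    ∃ b e : Finset X, b ⊆ e ∧ (b : Set X) ⊆ H ∧ Submodule.span (ZMod p) (e : Set X) = ⊤ ∧
      e.card = Module.finrank (ZMod p) X ∧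
      b.card = Module.finrank (ZMod p) (Submodule.span (ZMod p) H) := by
  classical
  obtain ⟨b, hbH, hbs, hb⟩ := exists_linearIndependent (ZMod p) H
  have hb' : LinearIndepOn (ZMod p) id b := hb
  have he := hb'.linearIndepOn_extend (Set.subset_univ b)
  have hes := hb'.span_extend_eq_span (Set.subset_univ b)
  rw [Submodule.span_univ] at hes
  refine ⟨b.toFinset, (hb'.extend (Set.subset_univ b)).toFinset, ?_, ?_, ?_, ?_, ?_⟩
  · exact Set.toFinset_subset_toFinset.2 (hb'.subset_extend _)
  · simpa using hbH
  · simpa using hes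
  · rw [← finrank_span_set_eq_card he, hes, finrank_top]
  · rw [← finrank_span_set_eq_card hb', hbs]

theorem finrank_le_of_le_degreeLTFun (d : ℕ) {V : Submodule (ZMod p) (X → ZMod p)}
    (hV : V ≤ degreeLTFun p X (d + 1)) :
    Module.finrank (ZMod p) V ≤ (Module.finrank (ZMod p) X + 1) ^ d := by
  induction d generalizing V with
  | zero =>
    let T : V →ₗ[ZMod p] ZMod p := (LinearMap.proj 0).comp V.subtype
    have hT : Function.Injective T := by
      refine (injective_iff_map_eq_zero T).2 fun v hv => Subtype.ext (funext fun x => ?_)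
      have h := mem_degreeLTFun_succ.1 (hV v.2) x
      have h2 : finiteDiff p x v.1 = 0 := by simpa [degreeLTFun] using h
      have h3 := congrFun h2 0
      have h4 : v.1 0 = 0 := hv
      simpa [h4] using h3
    simpa using LinearMap.finrank_le_finrank_of_injective hT
  | succ d ih =>
    obtain ⟨-, e, -, -, hes, hec, -⟩ := exists_finset_basis (p := p) (∅ : Set X)
    classical
    let T : Option X → (X → ZMod p) →ₗ[ZMod p] (X → ZMod p) := fun o =>
      o.elim (LinearMap.pi fun _ => LinearMap.proj 0) fun h => finiteDiff p h
    have h1 := finrank_le_sum_finrank_map (Finset.insertNone e) T V (by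
      intro f hf h
      have h0 : f 0 = 0 := congrFun (h none (by simp)) 0
      funext x
      rw [eq_of_finiteDiff_eq_zero hes (fun y hy => h (some y) (by simpa using hy)) x, h0]
      rfl)
    rw [Finset.sum_insertNone] at h1
    have h2 : Module.finrank (ZMod p) (V.map (T none)) ≤ 1 := by
      let S : V.map (T none) →ₗ[ZMod p] ZMod p := (LinearMap.proj 0).comp (V.map (T none)).subtype
      have hS : Function.Injective S := by
        refine (injective_iff_map_eq_zero S).2 fun v hv => Subtype.ext (funext fun x => ?_)
        obtain ⟨_, f, hf, rfl⟩ := v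
        exact hv
      simpa using LinearMap.finrank_le_finrank_of_injective hS
    have h3 := Finset.sum_le_card_nsmul e
      (fun h => Module.finrank (ZMod p) (V.map (T (some h)))) _
      fun h _ => ih (map_finiteDiff_le hV h)
    rw [hec, smul_eq_mul] at h3
    have h4 : 1 ≤ (Module.finrank (ZMod p) X + 1) ^ d := Nat.one_le_pow _ _ (Nat.succ_pos _)
    calc _ ≤ _ := h1
      _ ≤ (Module.finrank (ZMod p) X + 1) ^ d +
          Module.finrank (ZMod p) X * (Module.finrank (ZMod p) X + 1) ^ d :=
        add_le_add (h2.trans h4) h3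
      _ = _ := by ring

/-- A dense set has many popular differences: if `Z` has density at least `p ^ (-r)`, then the
set of `h` for which `Z ∩ (Z - h)` has density at least `p ^ (-(2 r + 1))` itself has density
at least `p ^ (-(2 r + 1))`. -/
theorem card_popular_differences [DecidableEq X] {q : ℕ} (hq : 2 ≤ q) (Z : Finset X) (r : ℕ)
    (hZ : Fintype.card X ≤ Z.card * q ^ r) :
    Fintype.card X ≤ (Finset.univ.filter fun h : X =>
      Fintype.card X ≤ (Z.filter fun x => x + h ∈ Z).card * q ^ (2 * r + 1)).card
        * q ^ (2 * r + 1) := by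
  by_contra! hlt
  set N := Fintype.card X
  set Q := q ^ (2 * r + 1) with hQ
  set H := Finset.univ.filter fun h : X => N ≤ (Z.filter fun x => x + h ∈ Z).card * Q
  have hsum : ∑ h : X, (Z.filter fun x => x + h ∈ Z).card = Z.card * Z.card := by
    simp_rw [Finset.card_filter]
    rw [Finset.sum_comm, Finset.card_eq_sum_ones, Finset.sum_mul]
    refine Finset.sum_congr rfl fun x _ => ?_
    rw [one_mul, ← Finset.card_filter,
      ← Finset.card_image_of_injective _ (add_right_injective x)]
    simp only [← Finset.card_eq_sum_ones]
    congr 1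
    ext y
    simp only [Finset.mem_image, Finset.mem_filter, Finset.mem_univ, true_and]
    exact ⟨by rintro ⟨h, hh, rfl⟩; exact hh, fun hy => ⟨y - x, by simpa using hy, by simp⟩⟩
  have hN : 0 < N := Fintype.card_pos
  have hZpos : 0 < Z.card := by
    rcases Nat.eq_zero_or_pos Z.card with h | h
    · simp [h] at hZ; omega
    · exact h
  have hZN : Z.card ≤ N := Finset.card_le_univ Z
  have hsplit : Z.card * Z.card * Q ≤ H.card * Q * Z.card + N * N := by
    rw [← hsum, Finset.sum_mul, ← Finset.sum_filter_add_sum_filter_not Finset.univ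
      (fun h : X => N ≤ (Z.filter fun x => x + h ∈ Z).card * Q)]
    refine add_le_add ?_ ?_
    · rw [mul_right_comm, mul_assoc, ← smul_eq_mul H.card]
      refine Finset.sum_le_card_nsmul _ _ _ fun h _ => ?_
      exact Nat.mul_le_mul_right _ (Finset.card_filter_le _ _)
    · refine (Finset.sum_le_card_nsmul _ _ N fun h hh => ?_).trans ?_
      · exact (not_le.1 (Finset.mem_filter.1 hh).2).le
      · exact Nat.mul_le_mul_right _ (Finset.card_le_univ _)
  have h1 : H.card * Q * Z.card < N * N :=
    (Nat.mul_lt_mul_of_pos_right hlt hZpos).trans_le (Nat.mul_le_mul_left _ hZN)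
  have h2 : 2 * (N * N) ≤ Z.card * Z.card * Q := by
    calc 2 * (N * N) ≤ q * ((Z.card * q ^ r) * (Z.card * q ^ r)) :=
          Nat.mul_le_mul hq (Nat.mul_le_mul hZ hZ)
      _ = _ := by rw [hQ]; ring
  omega

/-- Few independent functions of degree at most `d` vanish on a dense set: if `Z` has density at
least `p ^ (-r)`, then the functions vanishing on it form a space of dimension
`O (r n ^ (d - 1))`. -/
theorem finrank_mul_le_of_vanishing (d r : ℕ) (Z : Finset X)
    (hZ : Fintype.card X ≤ Z.card * p ^ r) {V : Submodule (ZMod p) (X → ZMod p)}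
    (hV : V ≤ degreeLTFun p X (d + 1)) (hVZ : ∀ f ∈ V, ∀ x ∈ Z, f x = 0) :
    Module.finrank (ZMod p) V * (Module.finrank (ZMod p) X + 1) ≤
      4 ^ d * (r + 1) * (Module.finrank (ZMod p) X + 1) ^ d := by
  classical
  have hp2 : 2 ≤ p := (Fact.out : p.Prime).two_le
  obtain ⟨z, hz⟩ : Z.Nonempty := by
    rw [Finset.nonempty_iff_ne_empty]
    rintro rfl
    simp at hZ
  induction d generalizing r Z V z with
  | zero =>
    have : V = ⊥ := by
      refine (Submodule.eq_bot_iff V).2 fun f hf => funext fun x => ?_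
      have h := mem_degreeLTFun_succ.1 (hV hf) (x - z)
      have h2 : finiteDiff p (x - z) f = 0 := by simpa [degreeLTFun] using h
      simpa [hVZ f hf z hz] using congrFun h2 z
    subst this
    simp
  | succ d ih =>
    set n := Module.finrank (ZMod p) X with hn
    set H := Finset.univ.filter fun h : X =>
      Fintype.card X ≤ (Z.filter fun x => x + h ∈ Z).card * p ^ (2 * r + 1) with hH
    have hHc := card_popular_differences hp2 Z r hZ
    rw [← hH] at hHc
    obtain ⟨b, e, hbe, hbH, hes, hec, hbc⟩ := exists_finset_basis (p := p) (H : Set X)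
    have hbn : n ≤ b.card + (2 * r + 1) := by
      have h1 : H.card ≤ p ^ b.card := by
        have h := Module.card_eq_pow_finrank (K := ZMod p)
          (V := Submodule.span (ZMod p) (H : Set X))
        rw [ZMod.card, ← hbc, ← Nat.card_eq_fintype_card] at h
        rw [← h, ← Nat.card_eq_finsetCard H]
        exact Nat.card_mono (Set.toFinite _) Submodule.subset_span
      have h2 : p ^ n ≤ p ^ (b.card + (2 * r + 1)) := by
        calc p ^ n = Fintype.card X := by
              rw [Module.card_eq_pow_finrank (K := ZMod p), ZMod.card]
          _ ≤ H.card * p ^ (2 * r + 1) := hHc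
          _ ≤ p ^ b.card * p ^ (2 * r + 1) := Nat.mul_le_mul_right _ h1
          _ = _ := (pow_add _ _ _).symm
      exact (Nat.pow_le_pow_iff_right hp2).1 h2
    have h1 := finrank_le_sum_finrank_map e (fun h => finiteDiff p h) V (by
      intro f hf h
      funext x
      rw [eq_of_finiteDiff_eq_zero hes h x, ← eq_of_finiteDiff_eq_zero hes h z, hVZ f hf z hz]
      rfl)
    rw [← Finset.sum_sdiff hbe] at h1
    have h2 := Finset.sum_le_card_nsmul (e \ b)
      (fun h => Module.finrank (ZMod p) (V.map (finiteDiff p h))) _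
      fun h _ => finrank_le_of_le_degreeLTFun d (map_finiteDiff_le hV h)
    have h3 := Finset.sum_le_card_nsmul b
      (fun h => Module.finrank (ZMod p) (V.map (finiteDiff p h)) * (n + 1))
      (4 ^ d * (2 * r + 1 + 1) * (n + 1) ^ d) (by
        intro h hb
        have hc := (Finset.mem_filter.1 (hbH hb)).2
        obtain ⟨z', hz'⟩ : (Z.filter fun x => x + h ∈ Z).Nonempty := by
          rw [Finset.nonempty_iff_ne_empty]
          intro h0
          simp [h0] at hc
        refine ih (2 * r + 1) _ hc (map_finiteDiff_le hV h) ?_ z' hz'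
        rintro _ ⟨f, hf, rfl⟩ x hx
        have hx := Finset.mem_filter.1 hx
        simp [hVZ f hf _ hx.1, hVZ f hf _ hx.2])
    rw [← Finset.sum_mul, smul_eq_mul] at h3
    rw [smul_eq_mul, Finset.card_sdiff_of_subset hbe, hec] at h2
    have hbn' : b.card ≤ n + 1 := by
      have := Finset.card_le_card hbe
      omega
    have h4 : n - b.card ≤ 2 * r + 1 := by omega
    have h5 : 1 ≤ 4 ^ d := Nat.one_le_pow _ _ (by norm_num)
    calc Module.finrank (ZMod p) V * (n + 1)
        ≤ (n - b.card) * (n + 1) ^ d * (n + 1)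
          + b.card * (4 ^ d * (2 * r + 1 + 1) * (n + 1) ^ d) := by
          refine (Nat.mul_le_mul_right _ h1).trans ?_
          rw [add_mul]
          exact add_le_add (Nat.mul_le_mul_right _ h2) h3
      _ ≤ (2 * r + 1) * (n + 1) ^ d * (n + 1)
          + (n + 1) * (4 ^ d * (2 * r + 1 + 1) * (n + 1) ^ d) := by gcongr
      _ = (2 * r + 1 + 4 ^ d * (2 * r + 2)) * (n + 1) ^ (d + 1) := by ring
      _ ≤ (4 ^ (d + 1) * (r + 1)) * (n + 1) ^ (d + 1) := by
          refine Nat.mul_le_mul_right _ ?_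
          have : r + 1 ≤ 4 ^ d * (r + 1) := Nat.le_mul_of_pos_left _ h5
          rw [pow_succ]
          nlinarith
      _ = _ := by ring

end DegreeFiltration

section Veronese

variable {p n d : ℕ}

theorem multiset_prod_mem_degreeLTFun (s : Multiset (Fin n)) :
    (fun x : Fin n → ZMod p => (s.map x).prod) ∈
      degreeLTFun p (Fin n → ZMod p) (Multiset.card s + 1) := by
  induction s using Multiset.induction with
  | empty => simpa using const_mem_degreeLTFun 0 (1 : ZMod p)
  | cons i s ih =>
    simpa using linear_mul_mem_degreeLTFun (Pi.evalAddMonoidHom (fun _ => ZMod p) i) ih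

/-- The polynomial function `x ↦ l (φ_d x)` attached to a linear functional `l`. -/
def veroneseDual (p n d : ℕ) :
    Module.Dual (ZMod p) (Sym (Fin n) d → ZMod p) →ₗ[ZMod p] ((Fin n → ZMod p) → ZMod p) where
  toFun l x := l (veronese p n d x)
  map_add' _ _ := rfl
  map_smul' _ _ := rfl

theorem veroneseDual_apply_eq_sum (l : Module.Dual (ZMod p) (Sym (Fin n) d → ZMod p))
    (x : Fin n → ZMod p) :
    veroneseDual p n d l x =
      ∑ m, l (Pi.single m 1) * ((m : Multiset (Fin n)).map x).prod := by
  change l (veronese p n d x) = _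
  rw [LinearMap.pi_apply_eq_sum_univ l]
  refine Finset.sum_congr rfl fun m _ => ?_
  rw [smul_eq_mul, mul_comm, veronese]
  congr 2
  ext m'
  simp [Pi.single_apply, eq_comm]

theorem veroneseDual_mem_degreeLTFun (l : Module.Dual (ZMod p) (Sym (Fin n) d → ZMod p)) :
    veroneseDual p n d l ∈ degreeLTFun p (Fin n → ZMod p) (d + 1) := by
  have : veroneseDual p n d l =
      ∑ m : Sym (Fin n) d, l (Pi.single m 1) • fun x : Fin n → ZMod p =>
        ((m : Multiset (Fin n)).map x).prod := by
    ext x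
    simp [veroneseDual_apply_eq_sum]
  rw [this]
  refine Submodule.sum_mem _ fun m _ => Submodule.smul_mem _ _ ?_
  have h := multiset_prod_mem_degreeLTFun (p := p) (m : Multiset (Fin n))
  rwa [show Multiset.card (m : Multiset (Fin n)) = d from m.2] at h

variable [Fact p.Prime]

/-- In degree `d < p`, a homogeneous polynomial that vanishes as a function is zero. -/
theorem veroneseDual_injective (hd : d < p) : Function.Injective (veroneseDual p n d) := by
  refine (injective_iff_map_eq_zero _).2 fun l hl => ?_
  let e : Sym (Fin n) d → Fin n →₀ ℕ := fun m => Multiset.toFinsupp (m : Multiset (Fin n))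
  have he : Function.Injective e := fun a b h => Subtype.ext (Multiset.toFinsupp.injective h)
  let P : MvPolynomial (Fin n) (ZMod p) :=
    ∑ m, MvPolynomial.monomial (e m) (l (Pi.single m 1))
  have hcoeff : ∀ m, P.coeff (e m) = l (Pi.single m 1) := by
    intro m
    simp [P, MvPolynomial.coeff_sum, MvPolynomial.coeff_monomial, he.eq_iff]
  have hP : P = 0 := by
    refine MvPolynomial.eq_zero_of_eval_eq_zero (Fin n) (ZMod p) P (fun x => ?_) ?_
    · have h := congrFun hl x
      rw [veroneseDual_apply_eq_sum] at h
      rw [map_sum, ← h.trans (Pi.zero_apply x)]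
      refine Finset.sum_congr rfl fun m _ => ?_
      rw [MvPolynomial.eval_monomial, Finset.prod_multiset_map_count]
      rfl
    · refine Submodule.sum_mem _ fun m _ => (MvPolynomial.mem_restrictDegree _ _ _).2 ?_
      intro s hs i
      have hs' := Finset.mem_singleton.1 (MvPolynomial.support_monomial_subset hs)
      subst hs'
      have h1 : (e m) i ≤ d := (Multiset.count_le_card i _).trans_eq m.2
      rw [ZMod.card]
      omega
  refine LinearMap.pi_ext' fun m => LinearMap.ext_ring ?_
  have h := hcoeff m
  rw [hP, MvPolynomial.coeff_zero] at h
  exact h.symm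

/-- If the set of `x` with `φ_d x ∈ W` has density at least `p ^ (-r)`, then `W` has codimension
`O (r n ^ (d - 1))`. -/
theorem codim_le_of_veronese_mem (hd : d + 1 < p) (r : ℕ)
    (W : Submodule (ZMod p) (Sym (Fin n) (d + 1) → ZMod p)) (Z : Finset (Fin n → ZMod p))
    (hZW : ∀ x ∈ Z, veronese p n (d + 1) x ∈ W) (hZ : p ^ n ≤ Z.card * p ^ r) :
    (n + (d + 1) - 1).choose (d + 1) ≤
      Module.finrank (ZMod p) W + 4 ^ (d + 1) * (r + 1) * (n + 1) ^ d := by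
  have hinj := veroneseDual_injective (n := n) hd
  have h := finrank_mul_le_of_vanishing (p := p) (d + 1) r Z (by simpa using hZ)
    (V := W.dualAnnihilator.map (veroneseDual p n (d + 1)))
    (Submodule.map_le_iff_le_comap.2 fun l _ => veroneseDual_mem_degreeLTFun l) (by
      rintro _ ⟨l, hl, rfl⟩ x hx
      exact (Submodule.mem_dualAnnihilator l).1 hl _ (hZW x hx))
  rw [← (Submodule.equivMapOfInjective _ hinj _).finrank_eq, Module.finrank_fin_fun,
    pow_succ (n + 1) d, ← mul_assoc _ ((n + 1) ^ d)] at h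
  have h1 := Nat.le_of_mul_le_mul_right h (Nat.succ_pos n)
  have h2 := Subspace.finrank_add_finrank_dualAnnihilator_eq W
  rw [Module.finrank_fintype_fun_eq_card, Sym.card_sym_eq_choose, Fintype.card_fin] at h2
  omega

end Veronese

/-- If for any fewer than `s` points the span of their images contains the image of at most a
proportion `1 / q` of all points, then at most a proportion `s / q` of the `s`-tuples have
linearly dependent images. -/
theorem card_not_linearIndependent_mul_le {K E X : Type*} [Field K] [AddCommGroup E] [Module K E]
    [Fintype X] (v : X → E) (q : ℕ) {s : ℕ}
    (hv : ∀ t < s, ∀ f : Fin t → X,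
      Nat.card {x // v x ∈ Submodule.span K (Set.range fun i => v (f i))} * q ≤ Fintype.card X) :
    Nat.card {f : Fin s → X // ¬ LinearIndependent K fun i => v (f i)} * q
      ≤ s * Fintype.card X ^ s := by
  classical
  induction s with
  | zero => simp
  | succ s ih =>
    specialize ih fun t ht => hv t (ht.trans (Nat.lt_succ_self s))
    have hs := hv s (Nat.lt_succ_self s)
    simp only [Nat.card_eq_fintype_card, Fintype.card_subtype] at ih hs ⊢
    set N := Fintype.card X
    set B := Finset.univ.filter fun f : Fin s → X => ¬ LinearIndependent K fun i => v (f i)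
    let Z : (Fin s → X) → Finset X := fun f =>
      Finset.univ.filter fun x => v x ∈ Submodule.span K (Set.range fun i => v (f i))
    have hsub : (Finset.univ.filter fun f : Fin (s + 1) → X =>
        ¬ LinearIndependent K fun i => v (f i)) ⊆
        ((Finset.univ ×ˢ B) ∪ Finset.univ.biUnion fun f => (Z f).image fun x => (x, f)).image
          (Fin.snocEquiv fun _ => X) := by
      intro f hf
      rw [Finset.mem_filter, linearIndependent_finSucc', not_and_or, not_not] at hf
      refine Finset.mem_image.2 ⟨(f (Fin.last s), Fin.init f), ?_, Fin.snoc_init_self f⟩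
      rcases hf.2 with h | h
      · exact Finset.mem_union_left _ (Finset.mem_product.2
          ⟨Finset.mem_univ _, Finset.mem_filter.2 ⟨Finset.mem_univ _, h⟩⟩)
      · exact Finset.mem_union_right _ (Finset.mem_biUnion.2 ⟨Fin.init f, Finset.mem_univ _,
          Finset.mem_image_of_mem _ (Finset.mem_filter.2 ⟨Finset.mem_univ _, h⟩)⟩)
    have hZ : (Finset.univ.biUnion fun f => (Z f).image fun x => (x, f)).card * q
        ≤ N ^ s * N := by
      refine (Nat.mul_le_mul_right _ Finset.card_biUnion_le).trans ?_
      rw [Finset.sum_mul]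
      refine (Finset.sum_le_card_nsmul _ _ N fun f _ =>
        (Nat.mul_le_mul_right _ Finset.card_image_le).trans (hs f)).trans ?_
      simp [N]
    calc _ ≤ ((Finset.univ ×ˢ B).card +
          (Finset.univ.biUnion fun f => (Z f).image fun x => (x, f)).card) * q :=
        Nat.mul_le_mul_right _ ((Finset.card_le_card hsub).trans
          (Finset.card_image_le.trans (Finset.card_union_le _ _)))
      _ = N * (B.card * q) +
          (Finset.univ.biUnion fun f => (Z f).image fun x => (x, f)).card * q := by
        rw [Finset.card_product, Finset.card_univ]; ring
      _ ≤ N * (s * N ^ s) + N ^ s * N := add_le_add (Nat.mul_le_mul_left _ ih) hZ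
      _ = _ := by ring

theorem card_not_linearIndependent_veronese_mul_le {p : ℕ} [Fact p.Prime] {n d r s : ℕ}
    (hd : d + 1 < p)
    (hs : s + 4 ^ (d + 1) * (r + 1) * (n + 1) ^ d ≤ (n + (d + 1) - 1).choose (d + 1)) :
    Nat.card {f : Fin s → (Fin n → ZMod p) //
        ¬ LinearIndependent (ZMod p) fun i => veronese p n (d + 1) (f i)} * p ^ r
      ≤ s * Fintype.card (Fin n → ZMod p) ^ s := by
  classical
  refine card_not_linearIndependent_mul_le _ _ fun t ht f => ?_
  by_contra! hlt
  rw [Nat.card_eq_fintype_card, Fintype.card_subtype] at hlt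
  have h := codim_le_of_veronese_mem hd r _ _ (fun x hx => (Finset.mem_filter.1 hx).2)
    (by simpa using hlt.le)
  have h2 := finrank_range_le_card (R := ZMod p) fun i => veronese p n (d + 1) (f i)
  rw [Set.finrank, Fintype.card_fin] at h2
  omega

/-- For every integer `k ≥ 3` and prime `p ≥ k`, there exist `γ ≥ 0` and `ε : ℝ⁺ → ℝ⁺`
with `ε(x) → 0` as `x → ∞` such that: if `s` is a positive integer with
`s ≤ binom(n+k-2, k-1) − γ·(log_p n)^{1+ε(n)}·n^{k-2}` and `x_1, …, x_s` are independent
uniform random vectors in `𝔽_p^n`, then `φ_{k-1}(x_1), …, φ_{k-1}(x_s)` are linearly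
independent with probability `1 − o(1)` as `n → ∞`. -/
theorem stmt1 (k p : ℕ) (hk : 3 ≤ k) [hp : Fact p.Prime] (hkp : k ≤ p) :
    ∃ γ : ℝ, 0 ≤ γ ∧
    ∃ ε : ℝ → ℝ, (∀ x : ℝ, 0 < x → 0 < ε x) ∧
      Filter.Tendsto ε Filter.atTop (nhds 0) ∧
      ∀ δ : ℝ, 0 < δ → ∃ N : ℕ, ∀ n : ℕ, N ≤ n → ∀ s : ℕ, 0 < s →
        (s : ℝ) ≤ ((n + k - 2).choose (k - 1) : ℝ)
            - γ * (Real.logb p n) ^ ((1 : ℝ) + ε n) * (n : ℝ) ^ (k - 2) →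
        (1 - δ) * (Fintype.card (Fin s → (Fin n → ZMod p)) : ℝ) ≤
          (Nat.card {f : Fin s → (Fin n → ZMod p) //
            LinearIndependent (ZMod p) (fun i : Fin s => veronese p n (k - 1) (f i))} : ℝ) := by
  obtain ⟨j, rfl⟩ : ∃ j, k = j + 3 := ⟨k - 3, by omega⟩
  have hp2 : 2 ≤ p := hp.out.two_le
  refine ⟨4 ^ (j + 2) * (2 * j + 7) * 2 ^ (j + 1), by positivity, fun x => x⁻¹,
    fun x => inv_pos.2, tendsto_inv_atTop_zero, fun δ hδ => ?_⟩
  refine ⟨max (max p (j + 1)) ⌈2 ^ (j + 2) / δ⌉₊, fun n hn s _ hs => ?_⟩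
  rw [max_le_iff, max_le_iff] at hn
  obtain ⟨⟨hpn, hjn⟩, hδn⟩ := hn
  have hn0 : 0 < n := by omega
  have hn0' : (0 : ℝ) < n := by exact_mod_cast hn0
  set L := Real.logb p n with hL
  have hp1 : (1 : ℝ) < p := by exact_mod_cast hp2
  have hL1 : 1 ≤ L := by
    rw [hL, Real.le_logb_iff_rpow_le hp1 hn0', Real.rpow_one]
    exact_mod_cast hpn
  set r := (j + 3) * (Nat.log p n + 1) with hr
  have hnr : n ^ (j + 3) ≤ p ^ r := by
    rw [hr, mul_comm, pow_mul]
    exact Nat.pow_le_pow_left (Nat.lt_pow_succ_log_self hp2 n).le _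
  have hrL : (r : ℝ) + 1 ≤ (2 * j + 7) * L := by
    have h1 : (Nat.log p n : ℝ) ≤ L := Real.natLog_le_logb n p
    have h2 : ((j : ℝ) + 3) * (Nat.log p n + 1) ≤ (j + 3) * (L + L) := by gcongr
    rw [hr]
    push_cast
    linarith
  have hLε : L ≤ L ^ (1 + (n : ℝ)⁻¹) := by
    have h : (1 : ℝ) ≤ 1 + (n : ℝ)⁻¹ := le_add_of_nonneg_right (inv_pos.2 hn0').le
    simpa using Real.rpow_le_rpow_of_exponent_le hL1 h
  have e1 : n + (j + 3) - 2 = n + (j + 1 + 1) - 1 := by omega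
  have e2 : j + 3 - 1 = j + 1 + 1 := rfl
  have e3 : j + 3 - 2 = j + 1 := rfl
  rw [e1, e2, e3] at hs
  rw [e2]
  have hsD : s + 4 ^ (j + 1 + 1) * (r + 1) * (n + 1) ^ (j + 1) ≤
      (n + (j + 1 + 1) - 1).choose (j + 1 + 1) := by
    have h1 : (4 : ℝ) ^ (j + 1 + 1) * (r + 1) * (n + 1) ^ (j + 1) ≤
        4 ^ (j + 2) * (2 * j + 7) * 2 ^ (j + 1) * L ^ (1 + (n : ℝ)⁻¹) * n ^ (j + 1) := by
      calc (4 : ℝ) ^ (j + 1 + 1) * (r + 1) * (n + 1) ^ (j + 1)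
          ≤ 4 ^ (j + 1 + 1) * ((2 * j + 7) * L ^ (1 + (n : ℝ)⁻¹)) * (2 * n) ^ (j + 1) := by
            have h2 : (n : ℝ) + 1 ≤ 2 * n := by
              have : (1 : ℝ) ≤ n := by exact_mod_cast hn0
              linarith
            gcongr
            exact hrL.trans (by gcongr)
        _ = _ := by rw [mul_pow]; ring
    have h2 : (s : ℝ) + 4 ^ (j + 1 + 1) * (r + 1) * (n + 1) ^ (j + 1) ≤
      ((n + (j + 1 + 1) - 1).choose (j + 1 + 1) : ℕ) := by linarith
    exact_mod_cast h2
  have hbad := card_not_linearIndependent_veronese_mul_le (p := p) (by omega) hsD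
  have hsn : s ≤ (2 * n) ^ (j + 2) := by
    calc s ≤ _ := (Nat.le_add_right _ _).trans hsD
      _ ≤ (n + (j + 1 + 1) - 1) ^ (j + 1 + 1) := Nat.choose_le_pow _ _
      _ ≤ _ := Nat.pow_le_pow_left (by omega) _
  have hsδ : (s : ℝ) ≤ δ * p ^ r := by
    calc (s : ℝ) ≤ (2 * n) ^ (j + 2) := by exact_mod_cast hsn
      _ = 2 ^ (j + 2) * n ^ (j + 2) := mul_pow _ _ _
      _ ≤ (δ * n) * n ^ (j + 2) := by
          gcongr
          exact (div_le_iff₀' hδ).1 (Nat.ceil_le.1 hδn)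
      _ = δ * n ^ (j + 3) := by ring
      _ ≤ δ * p ^ r := by
          gcongr
          exact_mod_cast hnr
  classical
  have hcompl := Fintype.card_subtype_compl fun f : Fin s → (Fin n → ZMod p) =>
    LinearIndependent (ZMod p) fun i => veronese p n (j + 1 + 1) (f i)
  have hle := Fintype.card_subtype_le fun f : Fin s → (Fin n → ZMod p) =>
    LinearIndependent (ZMod p) fun i => veronese p n (j + 1 + 1) (f i)
  rw [Nat.card_eq_fintype_card] at hbad ⊢
  have hM : Fintype.card (Fin s → (Fin n → ZMod p)) = Fintype.card (Fin n → ZMod p) ^ s := by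
    simp
  rw [← hM] at hbad
  set M := Fintype.card (Fin s → (Fin n → ZMod p))
  set G := Fintype.card {f : Fin s → (Fin n → ZMod p) //
    LinearIndependent (ZMod p) fun i => veronese p n (j + 1 + 1) (f i)}
  rw [hcompl] at hbad
  have hbad' : ((M : ℝ) - G) * p ^ r ≤ s * M := by
    rw [← Nat.cast_sub hle]
    exact_mod_cast hbad
  have hpr : (0 : ℝ) < p ^ r := by positivity
  have h3 : ((M : ℝ) - G) * p ^ r ≤ (δ * M) * p ^ r :=
    hbad'.trans ((mul_le_mul_of_nonneg_right hsδ (Nat.cast_nonneg M)).trans_eq (by ring))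
  linarith [le_of_mul_le_mul_right h3 hpr]
end
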